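/- arXiv:0709.1682 — 6 statements merged into one kernel-verified Lean document; each statement's English description precedes it below -/
import Mathlib

section
/- Let A be a Hermitian n×n complex matrix and let ρ′ be a positive-definite n×n density matrix. Then log Tr[exp(A + log ρ′)] = max over all n×n density matrices ρ of the quantity Tr(ρA) − R(ρ‖ρ′); moreover the maximum is attained exactly at the density matrix ρ_o := exp(A + log ρ′)/Tr[exp(A + log ρ′)] (i.e. Tr(ρA) − R(ρ‖ρ′) = log Tr[exp(A + log ρ′)] if and only if ρ = ρ_o). -/
open Matrix
open scoped ComplexOrder

/-- Functional calculus for Hermitian matrices: apply the real function `f` to the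
eigenvalues (junk value `0` for non-Hermitian input). -/
noncomputable def matFun {n : Type*} [Fintype n] [DecidableEq n] (f : ℝ → ℝ)
    (A : Matrix n n ℂ) : Matrix n n ℂ :=
  if hA : A.IsHermitian then
    (hA.eigenvectorUnitary : Matrix n n ℂ) * Matrix.diagonal (fun i => (f (hA.eigenvalues i) : ℂ)) *
      star (hA.eigenvectorUnitary : Matrix n n ℂ)
  else 0

/-- Matrix logarithm via the functional calculus with the real logarithm
(`Real.log 0 = 0` convention). -/
noncomputable def matLog {n : Type*} [Fintype n] [DecidableEq n] (A : Matrix n n ℂ) :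
    Matrix n n ℂ := matFun Real.log A

/-- Matrix exponential via the functional calculus with the real exponential. -/
noncomputable def matExp {n : Type*} [Fintype n] [DecidableEq n] (A : Matrix n n ℂ) :
    Matrix n n ℂ := matFun Real.exp A

/-- Quantum relative entropy `R(ρ‖ρ′) = Tr[ρ (log ρ − log ρ′)]`. -/
noncomputable def qRelEnt {n : Type*} [Fintype n] [DecidableEq n] (ρ ρ' : Matrix n n ℂ) : ℝ :=
  (Matrix.trace (ρ * (matLog ρ - matLog ρ'))).re

section MatFun

variable {n : Type*} [Fintype n] [DecidableEq n]

theorem matFun_of_isHermitian (f : ℝ → ℝ) {B : Matrix n n ℂ} (hB : B.IsHermitian) :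
    matFun f B = (hB.eigenvectorUnitary : Matrix n n ℂ) *
      Matrix.diagonal (fun i => (f (hB.eigenvalues i) : ℂ)) *
      star (hB.eigenvectorUnitary : Matrix n n ℂ) := dif_pos hB

theorem matFun_id {B : Matrix n n ℂ} (hB : B.IsHermitian) : matFun id B = B := by
  rw [matFun_of_isHermitian id hB]
  exact hB.spectral_theorem.symm

theorem isHermitian_matFun (f : ℝ → ℝ) (B : Matrix n n ℂ) : (matFun f B).IsHermitian := by
  by_cases hB : B.IsHermitian
  · rw [matFun_of_isHermitian f hB]
    refine isHermitian_mul_mul_conjTranspose _ (isHermitian_diagonal_of_self_adjoint _ ?_)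
    ext i
    simp
  · rw [matFun, dif_neg hB]
    exact isHermitian_zero

theorem posSemidef_matFun {f : ℝ → ℝ} (hf : ∀ x, 0 ≤ f x) (B : Matrix n n ℂ) :
    (matFun f B).PosSemidef := by
  by_cases hB : B.IsHermitian
  · rw [matFun_of_isHermitian f hB]
    refine (PosSemidef.diagonal fun i => ?_).mul_mul_conjTranspose_same _
    simpa using hf _
  · rw [matFun, dif_neg hB]
    exact PosSemidef.zero

theorem trace_matFun (f : ℝ → ℝ) {B : Matrix n n ℂ} (hB : B.IsHermitian) :
    (matFun f B).trace = ((∑ i, f (hB.eigenvalues i) : ℝ) : ℂ) := by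
  rw [matFun_of_isHermitian f hB, trace_mul_comm, ← mul_assoc, Unitary.coe_star_mul_self,
    one_mul, trace_diagonal]
  push_cast
  rfl

theorem matFun_mul_matFun (f g : ℝ → ℝ) {B : Matrix n n ℂ} (hB : B.IsHermitian) :
    matFun f B * matFun g B = matFun (fun x => f x * g x) B := by
  have h := Unitary.coe_star_mul_self hB.eigenvectorUnitary
  simp only [matFun_of_isHermitian _ hB, Complex.ofReal_mul, ← diagonal_mul_diagonal]
  simp only [mul_assoc]
  rw [← mul_assoc (star _) (hB.eigenvectorUnitary : Matrix n n ℂ), h, one_mul]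

theorem smul_matFun (c : ℝ) (f : ℝ → ℝ) {B : Matrix n n ℂ} (hB : B.IsHermitian) :
    (c : ℂ) • matFun f B = matFun (fun x => c * f x) B := by
  have h : diagonal (fun i => ((c * f (hB.eigenvalues i) : ℝ) : ℂ)) =
      (c : ℂ) • diagonal (fun i => (f (hB.eigenvalues i) : ℂ)) := by
    rw [← diagonal_smul]
    congr 1
    ext i
    simp
  rw [matFun_of_isHermitian _ hB, matFun_of_isHermitian _ hB, h, Matrix.mul_smul, Matrix.smul_mul]

/-- The change-of-basis matrix between the eigenbases of two Hermitian matrices. -/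
noncomputable def eigenOverlap {B C : Matrix n n ℂ} (hB : B.IsHermitian) (hC : C.IsHermitian) :
    Matrix.unitaryGroup n ℂ :=
  star hB.eigenvectorUnitary * hC.eigenvectorUnitary

theorem sum_normSq_row_of_unitary (U : Matrix.unitaryGroup n ℂ) (i : n) :
    ∑ j, Complex.normSq ((U : Matrix n n ℂ) i j) = 1 := by
  have hU : (U : Matrix n n ℂ) * star (U : Matrix n n ℂ) = 1 := Unitary.mul_star_self_of_mem U.2
  have h := congrFun (congrFun hU i) i
  simp only [mul_apply, star_apply, one_apply_eq, ← starRingEnd_apply, Complex.mul_conj] at h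
  exact_mod_cast h

theorem sum_normSq_col_of_unitary (U : Matrix.unitaryGroup n ℂ) (j : n) :
    ∑ i, Complex.normSq ((U : Matrix n n ℂ) i j) = 1 := by
  have h := congrFun (congrFun (Unitary.coe_star_mul_self U) j) j
  simp only [mul_apply, star_apply, one_apply_eq, ← starRingEnd_apply,
    ← Complex.normSq_eq_conj_mul_self] at h
  exact_mod_cast h

theorem trace_matFun_mul_matFun (f g : ℝ → ℝ) {B C : Matrix n n ℂ} (hB : B.IsHermitian)
    (hC : C.IsHermitian) :
    (matFun f B * matFun g C).trace =
      ((∑ i, ∑ j, Complex.normSq ((eigenOverlap hB hC : Matrix n n ℂ) i j) *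
        (f (hB.eigenvalues i) * g (hC.eigenvalues j)) : ℝ) : ℂ) := by
  have h : (matFun f B * matFun g C).trace =
      (diagonal (fun i => (f (hB.eigenvalues i) : ℂ)) * (eigenOverlap hB hC : Matrix n n ℂ) *
        (diagonal (fun i => (g (hC.eigenvalues i) : ℂ)) *
          star (eigenOverlap hB hC : Matrix n n ℂ))).trace := by
    rw [matFun_of_isHermitian f hB, matFun_of_isHermitian g hC, mul_assoc, mul_assoc,
      trace_mul_comm]
    simp only [eigenOverlap, Submonoid.coe_mul, Unitary.coe_star, star_mul, star_star, mul_assoc]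
  rw [h, trace]
  push_cast
  refine Finset.sum_congr rfl fun i _ => ?_
  rw [diag_apply, mul_apply]
  refine Finset.sum_congr rfl fun j _ => ?_
  rw [diagonal_mul, diagonal_mul, star_apply, ← starRingEnd_apply, ← Complex.mul_conj]
  ring

theorem matFun_eq_matFun_iff_eigenOverlap (f g : ℝ → ℝ) {B C : Matrix n n ℂ}
    (hB : B.IsHermitian) (hC : C.IsHermitian) :
    matFun f B = matFun g C ↔ ∀ i j, (eigenOverlap hB hC : Matrix n n ℂ) i j ≠ 0 →
      f (hB.eigenvalues i) = g (hC.eigenvalues j) := by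
  have hcomm : matFun f B = matFun g C ↔
      diagonal (fun i => (f (hB.eigenvalues i) : ℂ)) * (eigenOverlap hB hC : Matrix n n ℂ) =
        (eigenOverlap hB hC : Matrix n n ℂ) *
          diagonal (fun i => (g (hC.eigenvalues i) : ℂ)) := by
    have hBu := Unitary.coe_star_mul_self hB.eigenvectorUnitary
    have hBu' := Unitary.mul_star_self_of_mem hB.eigenvectorUnitary.2
    have hCu := Unitary.coe_star_mul_self hC.eigenvectorUnitary
    have hCu' := Unitary.mul_star_self_of_mem hC.eigenvectorUnitary.2
    rw [matFun_of_isHermitian f hB, matFun_of_isHermitian g hC, eigenOverlap,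
      Submonoid.coe_mul, Unitary.coe_star]
    generalize (hB.eigenvectorUnitary : Matrix n n ℂ) = V at *
    generalize (hC.eigenvectorUnitary : Matrix n n ℂ) = U at *
    generalize diagonal (fun i => (f (hB.eigenvalues i) : ℂ)) = D
    generalize diagonal (fun i => (g (hC.eigenvalues i) : ℂ)) = E
    constructor <;> intro h
    · calc D * (star V * U) = star V * V * D * star V * U := by rw [hBu]; noncomm_ring
        _ = star V * (V * D * star V) * U := by noncomm_ring
        _ = star V * U * E * (star U * U) := by rw [h]; noncomm_ring
        _ = star V * U * E := by rw [hCu, mul_one]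
    · calc V * D * star V = V * D * star V * (U * star U) := by rw [hCu', mul_one]
        _ = V * (D * (star V * U)) * star U := by noncomm_ring
        _ = V * star V * U * E * star U := by rw [h]; noncomm_ring
        _ = U * E * star U := by rw [hBu', one_mul]
  rw [hcomm, ← Matrix.ext_iff]
  refine forall₂_congr fun i j => ?_
  rw [diagonal_mul, mul_diagonal, mul_comm]
  refine ⟨fun h h0 => Complex.ofReal_injective (mul_left_cancel₀ h0 h), fun h => ?_⟩
  by_cases hij : (eigenOverlap hB hC : Matrix n n ℂ) i j = 0
  · rw [hij, zero_mul, zero_mul]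
  · rw [h hij]

end MatFun

theorem mul_log_sub_log_le {p q : ℝ} (hp : 0 ≤ p) (hq : 0 < q) :
    p * (Real.log q - Real.log p) ≤ q - p := by
  rcases hp.eq_or_lt with rfl | hp
  · simpa using hq.le
  · rw [← Real.log_div hq.ne' hp.ne']
    have h := mul_le_mul_of_nonneg_left (Real.log_le_sub_one_of_pos (div_pos hq hp)) hp.le
    rwa [mul_sub, mul_div_cancel₀ _ hp.ne', mul_one] at h

theorem eq_of_mul_log_sub_log_eq {p q : ℝ} (hp : 0 ≤ p) (hq : 0 < q)
    (h : p * (Real.log q - Real.log p) = q - p) : p = q := by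
  rcases hp.eq_or_lt with rfl | hp
  · linarith
  · by_contra hne
    rw [← Real.log_div hq.ne' hp.ne'] at h
    have h1 : q / p ≠ 1 := fun h1 => hne ((div_eq_one_iff_eq hp.ne').1 h1).symm
    have h2 := mul_lt_mul_of_pos_left (Real.log_lt_sub_one_of_pos (div_pos hq hp) h1) hp
    rw [mul_sub, mul_div_cancel₀ _ hp.ne', mul_one] at h2
    exact h2.ne h

section Gibbs

variable {n : Type*} [Fintype n] [DecidableEq n]

/-- The Gibbs variational principle for the free energy of a Hermitian matrix `H`. -/
theorem gibbs_variational [Nonempty n] {H ρ : Matrix n n ℂ} (hH : H.IsHermitian)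
    (hρ : ρ.PosSemidef) (hρtr : ρ.trace = 1) :
    (ρ * H).trace.re - (ρ * matLog ρ).trace.re ≤ Real.log (matExp H).trace.re ∧
      ((ρ * H).trace.re - (ρ * matLog ρ).trace.re = Real.log (matExp H).trace.re ↔
        ρ = (matExp H).trace⁻¹ • matExp H) := by
  have hB := hρ.isHermitian
  set p := hB.eigenvalues
  set e := hH.eigenvalues
  set Z : ℝ := ∑ j, Real.exp (e j) with hZ_def
  have hZ : 0 < Z := Finset.sum_pos (fun j _ => Real.exp_pos _) Finset.univ_nonempty
  have hZtr : (matExp H).trace = (Z : ℂ) := trace_matFun _ hH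
  have hp : ∀ i, 0 ≤ p i := hρ.eigenvalues_nonneg
  have hpsum : ∑ i, p i = 1 := by
    have h := trace_matFun id hB
    rw [matFun_id hB, hρtr] at h
    exact_mod_cast h.symm
  set q : n → ℝ := fun j => Z⁻¹ * Real.exp (e j) with hq_def
  have hq : ∀ j, 0 < q j := fun j => mul_pos (inv_pos.2 hZ) (Real.exp_pos _)
  have hqsum : ∑ j, q j = 1 := by
    rw [hq_def, ← Finset.mul_sum, ← hZ_def, inv_mul_cancel₀ hZ.ne']
  have hlogq : ∀ j, Real.log (q j) = e j - Real.log Z := fun j => by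
    rw [hq_def, Real.log_mul (inv_ne_zero hZ.ne') (Real.exp_ne_zero _), Real.log_inv,
      Real.log_exp]
    ring
  set d : n → n → ℝ := fun i j =>
    Complex.normSq ((eigenOverlap hB hH : Matrix n n ℂ) i j) with hd_def
  have hd : ∀ i j, 0 ≤ d i j := fun i j => Complex.normSq_nonneg _
  have hrow : ∀ i, ∑ j, d i j = 1 := sum_normSq_row_of_unitary _
  have hcol : ∀ j, ∑ i, d i j = 1 := sum_normSq_col_of_unitary _
  have sum_left : ∀ a : n → ℝ, ∑ i, ∑ j, d i j * a i = ∑ i, a i := fun a => by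
    simp only [← Finset.sum_mul, hrow, one_mul]
  have sum_right : ∀ a : n → ℝ, ∑ i, ∑ j, d i j * a j = ∑ j, a j := fun a => by
    rw [Finset.sum_comm]
    simp only [← Finset.sum_mul, hcol, one_mul]
  have henergy : (ρ * H).trace.re = ∑ i, ∑ j, d i j * (p i * e j) := by
    have h := trace_matFun_mul_matFun id id hB hH
    rw [matFun_id hB, matFun_id hH] at h
    rw [h, Complex.ofReal_re]
    rfl
  have hentropy : (ρ * matLog ρ).trace.re = ∑ i, p i * Real.log (p i) := by
    have h := matFun_mul_matFun id Real.log hB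
    rw [matFun_id hB] at h
    rw [matLog, h, trace_matFun _ hB, Complex.ofReal_re]
    rfl
  have hgap : (ρ * H).trace.re - (ρ * matLog ρ).trace.re - Real.log Z =
      ∑ i, ∑ j, d i j * (p i * (Real.log (q j) - Real.log (p i)) - (q j - p i)) := by
    have hsplit : ∀ i j, d i j * (p i * (Real.log (q j) - Real.log (p i)) - (q j - p i)) =
        d i j * (p i * e j) - d i j * (p i * Real.log (p i)) - d i j * (p i * Real.log Z) -
          d i j * q j + d i j * p i := fun i j => by
      rw [hlogq]
      ring
    simp only [hsplit, Finset.sum_add_distrib, Finset.sum_sub_distrib]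
    rw [sum_left p, sum_right q, sum_left fun i => p i * Real.log (p i),
      sum_left fun i => p i * Real.log Z, ← Finset.sum_mul, hpsum, hqsum, henergy, hentropy]
    ring
  have hterm : ∀ i j,
      d i j * (p i * (Real.log (q j) - Real.log (p i)) - (q j - p i)) ≤ 0 := fun i j =>
    mul_nonpos_of_nonneg_of_nonpos (hd i j)
      (sub_nonpos.2 (mul_log_sub_log_le (hp i) (hq j)))
  have hstate : (matExp H).trace⁻¹ • matExp H = matFun (fun x => Z⁻¹ * Real.exp x) H := by
    rw [hZtr, ← Complex.ofReal_inv, matExp, smul_matFun _ _ hH]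
  have hiff : ρ = matFun (fun x => Z⁻¹ * Real.exp x) H ↔
      ∀ i j, (eigenOverlap hB hH : Matrix n n ℂ) i j ≠ 0 → p i = q j := by
    have h := matFun_eq_matFun_iff_eigenOverlap id (fun x => Z⁻¹ * Real.exp x) hB hH
    rwa [matFun_id hB] at h
  rw [hstate, hZtr, Complex.ofReal_re, ← sub_nonpos, ← sub_eq_zero, hgap]
  refine ⟨Finset.sum_nonpos fun i _ => Finset.sum_nonpos fun j _ => hterm i j, fun h => ?_,
    fun h => ?_⟩
  · refine hiff.2 fun i j hij => ?_
    have hi := (Finset.sum_eq_zero_iff_of_nonpos fun i _ =>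
      Finset.sum_nonpos fun j _ => hterm i j).1 h i (Finset.mem_univ i)
    have hj := (Finset.sum_eq_zero_iff_of_nonpos fun j _ => hterm i j).1 hi j (Finset.mem_univ j)
    exact eq_of_mul_log_sub_log_eq (hp i) (hq j) (sub_eq_zero.1
      ((mul_eq_zero.1 hj).resolve_left (mt Complex.normSq_eq_zero.1 hij)))
  · refine Finset.sum_eq_zero fun i _ => Finset.sum_eq_zero fun j _ => ?_
    by_cases hij : (eigenOverlap hB hH : Matrix n n ℂ) i j = 0
    · rw [hd_def]
      simp only [hij, map_zero, zero_mul]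
    · rw [hiff.1 h i j hij, sub_self, sub_self, mul_zero, sub_self, mul_zero]

end Gibbs

/-- Duality lemma: for Hermitian `A` and a positive-definite density matrix `ρ′`,
`log Tr[exp(A + log ρ′)] = max_ρ (Tr(ρA) − R(ρ‖ρ′))`, the maximum being over all
density matrices `ρ` and attained exactly at
`ρₒ = exp(A + log ρ′)/Tr[exp(A + log ρ′)]`. -/
theorem quantum_duality {n : ℕ} (A ρ' : Matrix (Fin n) (Fin n) ℂ)
    (hA : A.IsHermitian) (hρ'pd : ρ'.PosDef) (hρ'tr : ρ'.trace = 1) :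
    let Z : Matrix (Fin n) (Fin n) ℂ := matExp (A + matLog ρ')
    let ρo : Matrix (Fin n) (Fin n) ℂ := (Matrix.trace Z)⁻¹ • Z
    -- `ρo` is a density matrix
    ρo.PosSemidef ∧ ρo.trace = 1 ∧
    -- the value `log Tr[exp(A + log ρ′)]` is an upper bound, attained exactly at `ρo`
    (∀ ρ : Matrix (Fin n) (Fin n) ℂ, ρ.PosSemidef → ρ.trace = 1 →
      ((Matrix.trace (ρ * A)).re - qRelEnt ρ ρ' ≤ Real.log (Matrix.trace Z).re ∧
        ((Matrix.trace (ρ * A)).re - qRelEnt ρ ρ' = Real.log (Matrix.trace Z).re ↔ ρ = ρo))) := by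
  intro Z ρo
  have : Nonempty (Fin n) := by
    rcases n with _ | n
    · simp [trace] at hρ'tr
    · exact ⟨0⟩
  have hH : (A + matLog ρ').IsHermitian := hA.add (isHermitian_matFun _ _)
  have hZpsd : Z.PosSemidef := posSemidef_matFun (fun x => (Real.exp_pos x).le) _
  have hZtr : Z.trace ≠ 0 := by
    rw [show Z = matFun Real.exp (A + matLog ρ') from rfl, trace_matFun _ hH]
    exact Complex.ofReal_ne_zero.2
      (Finset.sum_pos (fun j _ => Real.exp_pos _) Finset.univ_nonempty).ne'
  refine ⟨hZpsd.smul (inv_nonneg_of_nonneg hZpsd.trace_nonneg), ?_, fun ρ hρ hρtr => ?_⟩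
  · rw [trace_smul, smul_eq_mul, inv_mul_cancel₀ hZtr]
  · have hsplit : (ρ * A).trace.re - qRelEnt ρ ρ' =
        (ρ * (A + matLog ρ')).trace.re - (ρ * matLog ρ).trace.re := by
      simp only [qRelEnt, mul_add, mul_sub, trace_add, trace_sub, Complex.add_re,
        Complex.sub_re]
      ring
    rw [hsplit]
    exact gibbs_variational hH hρ hρtr
end

section
/- (Spectral theorem, finite-dimensional case.) Let C be a commutative *-subalgebra of the n×n complex matrices and let 𝕡 be a state on C. Then there exist a σ-algebra F on the finite set Ω = {1,…,n}, a probability measure P on (Ω,F), and a map ι from C to complex-valued functions on Ω such that: ι is linear and injective, ι(AB) = ι(A)·ι(B) pointwise and ι(A*) is the pointwise complex conjugate of ι(A) for all A, B ∈ C, the range of ι is exactly the set of F-measurable functions Ω → ℂ, and 𝕡(A) = E_P[ι(A)] (the integral of ι(A) against P) for all A ∈ C. -/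
open Matrix MeasureTheory
open scoped ComplexOrder

section Diagonalization

variable {A E : Type*} [Ring A] [StarRing A] [Algebra ℂ A] [StarModule ℂ A]
  [NormedAddCommGroup E] [InnerProductSpace ℂ E] [FiniteDimensional ℂ E]

/-- The joint eigenvectors of a commutative *-algebra of operators on a finite-dimensional
complex inner product space span the space. -/
theorem span_joint_eigenvectors_eq_top (hA : ∀ a b : A, a * b = b * a)
    (φ : A →⋆ₐ[ℂ] (E →L[ℂ] E)) :
    Submodule.span ℂ {v : E | v ≠ 0 ∧ ∀ a, ∃ μ : ℂ, φ a v = μ • v} = ⊤ := by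
  have hsymm : ∀ a : selfAdjoint A, (φ (a : A) : E →ₗ[ℂ] E).IsSymmetric := fun a =>
    (a.2.map φ).isSymmetric
  have hcomm : Pairwise
      (Function.onFun Commute fun a : selfAdjoint A => (φ (a : A) : E →ₗ[ℂ] E)) := by
    intro a b _
    ext v
    have h := congrArg φ (hA a b)
    simp only [map_mul] at h
    exact DFunLike.congr_fun h v
  rw [eq_top_iff, ← LinearMap.IsSymmetric.iSup_iInf_eq_top_of_commute hsymm hcomm]
  refine iSup_le fun χ v hv => ?_
  rcases eq_or_ne v 0 with rfl | hv0
  · exact zero_mem _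
  refine Submodule.subset_span ⟨hv0, fun a =>
    ⟨χ (realPart a) + Complex.I * χ (imaginaryPart a), ?_⟩⟩
  simp only [Submodule.mem_iInf, Module.End.mem_eigenspace_iff] at hv
  have hr : φ (realPart a : A) v = χ (realPart a) • v := hv _
  have hi : φ (imaginaryPart a : A) v = χ (imaginaryPart a) • v := hv _
  conv_lhs => rw [← realPart_add_I_smul_imaginaryPart a]
  simp [hr, hi, add_smul, mul_smul]

/-- A commutative *-algebra acting faithfully on an `n`-dimensional complex inner product space
embeds into the algebra of functions on an `n`-point set. -/
theorem exists_starAlgHom_pi_injective {n : ℕ} (hn : Module.finrank ℂ E = n)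
    (hA : ∀ a b : A, a * b = b * a) (φ : A →⋆ₐ[ℂ] (E →L[ℂ] E)) (hφ : Function.Injective φ) :
    ∃ ψ : A →⋆ₐ[ℂ] (Fin n → ℂ), Function.Injective ψ := by
  have hspan := (span_joint_eigenvectors_eq_top hA φ).ge
  let b₀ := Module.Basis.ofSpan hspan
  let b := b₀.reindex (b₀.indexEquiv (Module.finBasisOfFinrankEq ℂ E hn))
  have hb : ∀ i, b i ≠ 0 ∧ ∀ a, ∃ μ : ℂ, φ a (b i) = μ • b i := fun i =>
    Module.Basis.ofSpan_subset hspan (by simp [b, b₀])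
  choose hb0 χ hχ using hb
  have huniq : ∀ {i a μ}, φ a (b i) = μ • b i → χ i a = μ := fun {i a μ} h =>
    smul_left_injective ℂ (hb0 i) ((hχ i a).symm.trans h)
  refine ⟨{ toFun := fun a i => χ i a
            map_one' := funext fun i => huniq (by simp)
            map_mul' := fun a c => funext fun i => huniq ?_
            map_zero' := funext fun i => huniq (by simp)
            map_add' := fun a c => funext fun i => huniq (by simp [hχ, add_smul])
            commutes' := fun r => funext fun i => huniq ?_
            map_star' := fun a => funext fun i => ?_ }, fun a c hac => hφ ?_⟩
  · simp [hχ, smul_smul, mul_comm]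
  · simp [Algebra.algebraMap_eq_smul_one]
  · have h : inner ℂ (φ (star a) (b i)) (b i) = inner ℂ (b i) (φ a (b i)) := by
      rw [map_star, ContinuousLinearMap.star_eq_adjoint, ContinuousLinearMap.adjoint_inner_left]
    rw [hχ, hχ, inner_smul_left, inner_smul_right] at h
    have h' := mul_right_cancel₀ (inner_self_ne_zero.mpr (hb0 i)) h
    rw [Pi.star_apply, ← h']
    simp
  · apply ContinuousLinearMap.coe_injective
    refine b.ext fun i => ?_
    have h : χ i a = χ i c := congrFun hac i
    simp [hχ, h]

end Diagonalization

section Interpolation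

variable {A Ω : Type*} [Ring A] [StarRing A] [Algebra ℂ A] [Fintype Ω]

open Classical in
/-- The range of an algebra homomorphism into functions on a finite set contains the indicators of
the classes of points that it does not separate. -/
theorem exists_apply_eq_indicator (ψ : A →⋆ₐ[ℂ] (Ω → ℂ)) (i : Ω) :
    ∃ e : A, ∀ j, ψ e j = if ∀ a, ψ a j = ψ a i then 1 else 0 := by
  have hsep : ∀ k : Ω, ∃ d : A, ψ d i = 1 ∧ ((¬ ∀ a, ψ a k = ψ a i) → ψ d k = 0) := by
    intro k
    by_cases h : ∀ a, ψ a k = ψ a i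
    · exact ⟨1, by simp, fun h' => absurd h h'⟩
    · push Not at h
      obtain ⟨a, ha⟩ := h
      refine ⟨(ψ a i - ψ a k)⁻¹ • (a - algebraMap ℂ A (ψ a k)), ?_, fun _ => ?_⟩
      · simp [AlgHomClass.commutes, inv_mul_cancel₀ (sub_ne_zero.mpr ha.symm)]
      · simp [AlgHomClass.commutes]
  choose d hdi hdk using hsep
  refine ⟨(Finset.univ.toList.map d).prod, fun j => ?_⟩
  have hprod : ∀ j, ψ (Finset.univ.toList.map d).prod j = ∏ k, ψ (d k) j := by
    intro j
    rw [map_list_prod, List.map_map, ← Finset.prod_apply, ← Finset.prod_map_toList]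
    rfl
  split_ifs with h
  · rw [h, hprod]
    simp [hdi]
  · rw [hprod]
    exact Finset.prod_eq_zero (Finset.mem_univ j) (hdk j h)

open Classical in
/-- Every function on a finite set that is constant on the classes of points not separated by `ψ`
is interpolated by a fixed family of scaled class indicators. -/
theorem exists_interpolating_family (ψ : A →⋆ₐ[ℂ] (Ω → ℂ)) :
    ∃ (e : Ω → A) (r : Ω → ℝ), (∀ i, 0 ≤ r i) ∧ (∀ i, ψ (star (e i) * e i) = ψ (e i)) ∧
      ∀ f : Ω → ℂ, (∀ i j, (∀ a, ψ a i = ψ a j) → f i = f j) →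
        ψ (∑ i, (f i * r i) • e i) = f := by
  choose e he using exists_apply_eq_indicator ψ
  refine ⟨e, fun i => (Finset.card {j | ∀ a, ψ a j = ψ a i} : ℝ)⁻¹, fun i => by positivity,
    fun i => ?_, fun f hf => ?_⟩
  · ext j
    rw [map_mul, map_star, Pi.mul_apply, Pi.star_apply, he]
    split_ifs <;> simp
  · ext j
    simp only [map_sum, map_smul, Finset.sum_apply, Pi.smul_apply, he, smul_eq_mul, mul_ite,
      mul_one, mul_zero]
    rw [← Finset.sum_filter]
    have hterm : ∀ i ∈ ({i | ∀ a, ψ a j = ψ a i} : Finset Ω),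
        f i * (((Finset.card {j | ∀ a, ψ a j = ψ a i} : ℝ)⁻¹ : ℝ) : ℂ)
          = f j * (((Finset.card {i | ∀ a, ψ a j = ψ a i} : ℝ)⁻¹ : ℝ) : ℂ) := by
      intro i hi
      have hi' : ∀ a, ψ a j = ψ a i := by simpa using hi
      simp only [hf j i hi', ← hi', eq_comm]
    rw [Finset.sum_congr rfl hterm, Finset.sum_const, nsmul_eq_mul]
    have hcard : (Finset.card {i | ∀ a, ψ a j = ψ a i} : ℂ) ≠ 0 :=
      Nat.cast_ne_zero.mpr (Finset.card_ne_zero.mpr ⟨j, by simp⟩)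
    push_cast
    field_simp

end Interpolation

/-- A function is measurable for the σ-algebra of all preimages under `g` exactly when it is
constant on the fibres of `g`. -/
theorem measurable_comap_top_iff {Ω X Y : Type*} [MeasurableSpace Y] [MeasurableSingletonClass Y]
    (g : Ω → X) (f : Ω → Y) :
    Measurable[MeasurableSpace.comap g ⊤] f ↔ ∀ i j, g i = g j → f i = f j := by
  refine ⟨fun hf i j hij => ?_, fun hf s _ => ⟨g '' (f ⁻¹' s), trivial, ?_⟩⟩
  · obtain ⟨t, -, ht⟩ := hf (measurableSet_singleton (f i))
    have hi : i ∈ f ⁻¹' {f i} := rfl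
    rw [← ht, Set.mem_preimage, hij, ← Set.mem_preimage, ht] at hi
    exact hi.symm
  · ext j
    constructor
    · rintro ⟨i, hi, hij⟩
      rwa [Set.mem_preimage, ← hf i j hij]
    · exact fun hj => ⟨j, hj, rfl⟩

/-- The integral of a measurable function against a finite combination of Dirac masses. -/
theorem integral_sum_ofReal_smul_dirac {Ω : Type*} [Fintype Ω] [MeasurableSpace Ω] {w : Ω → ℝ}
    (hw : ∀ i, 0 ≤ w i) {f : Ω → ℂ} (hf : Measurable f) :
    ∫ ω, f ω ∂(∑ i, ENNReal.ofReal (w i) • Measure.dirac i) = ∑ i, (w i : ℂ) * f i := by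
  rw [integral_finsetSum_measure]
  · refine Finset.sum_congr rfl fun i _ => ?_
    rw [integral_smul_measure, integral_dirac' _ _ hf.stronglyMeasurable,
      ENNReal.toReal_ofReal (hw i), Complex.real_smul]
  · intro i _
    refine Integrable.smul_measure ?_ ENNReal.ofReal_ne_top
    exact integrable_dirac' hf.stronglyMeasurable (by simp)

/-- Spectral theorem (finite-dimensional case): a commutative *-subalgebra `C` of the
`n×n` complex matrices together with a state `𝕡` on it is *-isomorphic to the algebra of
measurable functions on a probability space `({1,…,n}, F, P)`, carrying `𝕡` to the
expectation with respect to `P`. -/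
theorem spectral_theorem_commutative_state {n : ℕ}
    (C : StarSubalgebra ℂ (Matrix (Fin n) (Fin n) ℂ))
    (hcomm : ∀ A ∈ C, ∀ B ∈ C, A * B = B * A)
    (𝕡 : C →ₗ[ℂ] ℂ)
    (hpos : ∀ a : C, 0 ≤ (𝕡 (star a * a)).re ∧ (𝕡 (star a * a)).im = 0)
    (hone : 𝕡 1 = 1) :
    ∃ F : MeasurableSpace (Fin n), ∃ P : @Measure (Fin n) F,
      @IsProbabilityMeasure (Fin n) F P ∧
      ∃ ι : C → (Fin n → ℂ),
        -- `ι` is linear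
        (∀ a b : C, ι (a + b) = ι a + ι b) ∧
        (∀ (c : ℂ) (a : C), ι (c • a) = c • ι a) ∧
        -- `ι` is injective
        Function.Injective ι ∧
        -- `ι` is multiplicative and *-preserving (pointwise)
        (∀ a b : C, ι (a * b) = fun ω => ι a ω * ι b ω) ∧
        (∀ a : C, ι (star a) = fun ω => starRingEnd ℂ (ι a ω)) ∧
        -- the range of `ι` is exactly the set of `F`-measurable functions
        (Set.range ι = {f : Fin n → ℂ | @Measurable (Fin n) ℂ F _ f}) ∧
        -- `𝕡` is the expectation with respect to `P`
        (∀ a : C, 𝕡 a = ∫ ω, ι a ω ∂P) := by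
  let Φ : Matrix (Fin n) (Fin n) ℂ →⋆ₐ[ℂ]
      (EuclideanSpace ℂ (Fin n) →L[ℂ] EuclideanSpace ℂ (Fin n)) :=
    (Matrix.toEuclideanCLM (n := Fin n) (𝕜 := ℂ) : _ ≃⋆ₐ[ℂ] _)
  have hΦ : Function.Injective Φ := (Matrix.toEuclideanCLM (n := Fin n) (𝕜 := ℂ)).injective
  obtain ⟨ψ, hψ⟩ : ∃ ψ : C →⋆ₐ[ℂ] (Fin n → ℂ), Function.Injective ψ :=
    exists_starAlgHom_pi_injective (finrank_euclideanSpace_fin (𝕜 := ℂ))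
      (fun a b => Subtype.ext (hcomm a a.2 b b.2)) (Φ.comp C.subtype)
      (hΦ.comp Subtype.val_injective)
  obtain ⟨e, r, hr, he, hinterp⟩ := exists_interpolating_family ψ
  let w : Fin n → ℝ := fun i => r i * (𝕡 (e i)).re
  have hpe : ∀ i, 0 ≤ (𝕡 (e i)).re ∧ (𝕡 (e i)).im = 0 := fun i => by
    simpa only [hψ (he i)] using hpos (e i)
  have hw : ∀ i, 0 ≤ w i := fun i => mul_nonneg (hr i) (hpe i).1
  have hstate : ∀ a, 𝕡 a = ∑ i, (w i : ℂ) * ψ a i := fun a => by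
    conv_lhs => rw [← hψ (hinterp (ψ a) fun i j h => h a)]
    rw [map_sum]
    refine Finset.sum_congr rfl fun i _ => ?_
    have hre : 𝕡 (e i) = ((𝕡 (e i)).re : ℂ) := Complex.ext rfl (by simp [(hpe i).2])
    rw [map_smul, hre, smul_eq_mul]
    simp only [w, Complex.ofReal_mul]
    ring
  have hsum : ∑ i, w i = 1 := by
    have h := hstate 1
    simp only [hone, map_one, Pi.one_apply, mul_one] at h
    exact_mod_cast h.symm
  let g : Fin n → C → ℂ := fun i a => ψ a i
  let F : MeasurableSpace (Fin n) := MeasurableSpace.comap g ⊤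
  have hmeas : ∀ f : Fin n → ℂ, Measurable f ↔ ∀ i j, g i = g j → f i = f j :=
    measurable_comap_top_iff g
  have hψmeas : ∀ a, Measurable (ψ a) := fun a => (hmeas _).mpr fun i j h => congrFun h a
  refine ⟨F, ∑ i, ENNReal.ofReal (w i) • Measure.dirac i, ⟨?_⟩, ψ, map_add ψ, map_smul ψ, hψ,
    map_mul ψ, map_star ψ, ?_, fun a => ?_⟩
  · simp [← ENNReal.ofReal_sum_of_nonneg fun i _ => hw i, hsum]
  · ext f
    refine ⟨?_, fun hf => ⟨_, hinterp f fun i j h => (hmeas f).mp hf i j (funext h)⟩⟩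
    rintro ⟨a, rfl⟩
    exact hψmeas a
  · rw [integral_sum_ofReal_smul_dirac hw (hψmeas a), hstate]
end

section
/- (Existence of the quantum conditional expectation.) Let C be a commutative *-subalgebra of the n×n complex matrices, let C′ := {A : AK = KA for all K ∈ C} be its commutant, let ρ be an n×n density matrix, and set 𝕡(X) := Tr(ρX). Then there exists a linear map E : C′ → C such that E(A*) = E(A)* for all A ∈ C′ and 𝕡(E(A)·K) = 𝕡(A·K) for all A ∈ C′ and all K ∈ C. -/
open Matrix
open scoped ComplexOrder

open scoped MatrixOrder in
/-- If `Tr(ρ Kᴴ K) = 0` for a positive semidefinite `ρ`, then `K ρ = 0`. -/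
theorem Matrix.PosSemidef.mul_eq_zero_of_trace_mul_conjTranspose_mul_self
    {m : Type*} [Fintype m] {ρ K : Matrix m m ℂ}
    (hρ : ρ.PosSemidef) (h : (ρ * (Kᴴ * K)).trace = 0) : K * ρ = 0 := by
  classical
  obtain ⟨B, rfl⟩ := CStarAlgebra.nonneg_iff_eq_star_mul_self.mp hρ.nonneg
  rw [star_eq_conjTranspose] at *
  have hB : B * Kᴴ = 0 := by
    rw [← trace_conjTranspose_mul_self_eq_zero_iff, conjTranspose_mul,
      conjTranspose_conjTranspose, ← h, Matrix.mul_assoc, trace_mul_comm]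
    simp only [Matrix.mul_assoc]
  have hK : K * Bᴴ = 0 := by
    simpa using congrArg Matrix.conjTranspose hB
  rw [← Matrix.mul_assoc, hK, Matrix.zero_mul]

/-- Reversal of a product of Hermitian conjugates under the functional `X ↦ Tr(ρ X)`. -/
theorem Matrix.IsHermitian.trace_mul_star_mul {m : Type*} [Fintype m]
    {ρ : Matrix m m ℂ} (hρ : ρ.IsHermitian) (A K : Matrix m m ℂ) :
    (ρ * (star A * K)).trace = star (ρ * (star K * A)).trace := by
  rw [← trace_conjTranspose, conjTranspose_mul, hρ.eq, trace_mul_comm]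
  simp [star_eq_conjTranspose]

/-- A linear solution operator for `Tr(ρ E(A) K) = Tr(ρ A K)`, `K ∈ C`. -/
theorem exists_linearMap_trace_mul_eq {m : Type*} [Fintype m] [DecidableEq m]
    (C : StarSubalgebra ℂ (Matrix m m ℂ))
    (hcomm : ∀ A ∈ C, ∀ B ∈ C, A * B = B * A)
    {ρ : Matrix m m ℂ} (hρ : ρ.PosSemidef) :
    ∃ F : Matrix m m ℂ →ₗ[ℂ] Matrix m m ℂ, ∀ A, F A ∈ C ∧
      ∀ K ∈ C, (ρ * (F A * K)).trace = (ρ * (A * K)).trace := by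
  let V : Submodule ℂ (Matrix m m ℂ) := Subalgebra.toSubmodule C.toSubalgebra
  let L : Matrix m m ℂ →ₗ[ℂ] Matrix m m ℂ →ₗ[ℂ] ℂ :=
    LinearMap.mk₂ ℂ (fun A K => (ρ * (A * K)).trace)
      (by simp [Matrix.add_mul, Matrix.mul_add]) (by simp)
      (by simp [Matrix.mul_add]) (by simp)
  let S : Matrix m m ℂ →ₗ[ℂ] Module.Dual ℂ V := L.compl₂ V.subtype
  let T : V →ₗ[ℂ] Module.Dual ℂ V := S ∘ₗ V.subtype
  have hS (A : Matrix m m ℂ) (K : V) : S A K = (ρ * (A * K.1)).trace := rfl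
  have hT (X K : V) : T X K = (ρ * (X.1 * K.1)).trace := rfl
  have hrange (A : Matrix m m ℂ) : S A ∈ LinearMap.range T := by
    have hker : S A ∈ (LinearMap.ker T).dualAnnihilator := by
      rw [Submodule.mem_dualAnnihilator]
      intro K hK
      have hstar : star K.1 ∈ C := star_mem (show K.1 ∈ C from K.2)
      have h0 : (ρ * (K.1ᴴ * K.1)).trace = 0 := by
        have h := hT K ⟨star K.1, hstar⟩
        rw [LinearMap.mem_ker.mp hK] at h
        rw [← star_eq_conjTranspose, hcomm _ hstar _ K.2]
        exact h.symm
      rw [hS, ← Matrix.mul_assoc, trace_mul_comm, ← Matrix.mul_assoc,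
        hρ.mul_eq_zero_of_trace_mul_conjTranspose_mul_self h0, Matrix.zero_mul, trace_zero]
    rw [← LinearMap.range_dualMap_eq_dualAnnihilator_ker] at hker
    obtain ⟨φ, hφ⟩ := hker
    obtain ⟨X, rfl⟩ := (Module.evalEquiv ℂ V).surjective φ
    refine ⟨X, LinearMap.ext fun K => ?_⟩
    rw [← hφ, hT, hcomm _ X.2 _ K.2]
    rfl
  obtain ⟨G, hG⟩ := Module.projective_lifting_property T.rangeRestrict
    (S.codRestrict (LinearMap.range T) hrange) T.surjective_rangeRestrict
  refine ⟨V.subtype ∘ₗ G, fun A => ⟨(G A).2, fun K hK => ?_⟩⟩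
  have h : T (G A) = S A := congrArg Subtype.val (LinearMap.congr_fun hG A)
  exact LinearMap.congr_fun h ⟨K, hK⟩

/-- Existence of the quantum conditional expectation: for a commutative *-subalgebra `C`
of the `n×n` complex matrices with commutant `C′`, a density matrix `ρ` and the state
`𝕡(X) = Tr(ρX)`, there is a linear, *-preserving map `E : C′ → C` with
`𝕡(E(A)K) = 𝕡(AK)` for all `A ∈ C′`, `K ∈ C`. -/
theorem quantum_conditional_expectation_exists {n : ℕ}
    (C : StarSubalgebra ℂ (Matrix (Fin n) (Fin n) ℂ))
    (hcomm : ∀ A ∈ C, ∀ B ∈ C, A * B = B * A)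
    (ρ : Matrix (Fin n) (Fin n) ℂ) (hρ : ρ.PosSemidef) (hρtr : ρ.trace = 1) :
    ∃ E : Matrix (Fin n) (Fin n) ℂ → Matrix (Fin n) (Fin n) ℂ,
      -- `E` maps the commutant `C′` into `C`
      (∀ A, (∀ K ∈ C, A * K = K * A) → E A ∈ C) ∧
      -- `E` is linear on the commutant
      (∀ A B, (∀ K ∈ C, A * K = K * A) → (∀ K ∈ C, B * K = K * B) →
        E (A + B) = E A + E B) ∧
      (∀ (c : ℂ) A, (∀ K ∈ C, A * K = K * A) → E (c • A) = c • E A) ∧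
      -- `E` is *-preserving
      (∀ A, (∀ K ∈ C, A * K = K * A) → E (star A) = star (E A)) ∧
      -- the defining property of the conditional expectation
      (∀ A, (∀ K ∈ C, A * K = K * A) → ∀ K ∈ C,
        Matrix.trace (ρ * (E A * K)) = Matrix.trace (ρ * (A * K))) := by
  obtain ⟨F, hF⟩ := exists_linearMap_trace_mul_eq C hcomm hρ
  refine ⟨fun A => (2⁻¹ : ℂ) • (F A + star (F (star A))), ?_, ?_, ?_, ?_, ?_⟩
  · exact fun A _ => C.smul_mem (add_mem (hF A).1 (star_mem (hF (star A)).1)) _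
  · intro A B _ _
    simp only [star_add, map_add, ← smul_add]
    congr 1
    abel
  · intro c A _
    simp [smul_comm c]
  · intro A _
    simp [add_comm]
  · intro A hA K hK
    have hstar : (ρ * (star (F (star A)) * K)).trace = (ρ * (A * K)).trace := by
      rw [hρ.isHermitian.trace_mul_star_mul, hcomm _ (star_mem hK) _ (hF _).1,
        (hF _).2 _ (star_mem hK), ← hρ.isHermitian.trace_mul_star_mul, hA K hK]
      simp
    rw [Matrix.smul_mul, Matrix.mul_smul, trace_smul, Matrix.add_mul, Matrix.mul_add,
      trace_add, hstar, (hF A).2 K hK, smul_eq_mul]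
    ring
end

section
/- For all 1 ≤ l ≤ k ≤ N one has U(k)*·ΔW(l)·U(k) = U(l)*·ΔW(l)·U(l) = ΔY(l); that is, the output increment ΔY(l) is unchanged by conjugation with any later unitary U(k), k ≥ l. -/
open Matrix
open scoped ComplexOrder BigOperators

noncomputable section DiscreteField

/-- Index set of the total Hilbert space `ℂ^d ⊗ (ℂ²)^{⊗N}`. -/
abbrev TIdx (d N : ℕ) := Fin d × (Fin N → Fin 2)

/-- Operators on the total Hilbert space. -/
abbrev TOp (d N : ℕ) := Matrix (TIdx d N) (TIdx d N) ℂ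

/-- The lowering operator `σ₋` (entry `(2,1)` equal to `1`). -/
def sigmaMinus : Matrix (Fin 2) (Fin 2) ℂ := !![0, 0; 1, 0]

/-- The raising operator `σ₊ = σ₋*`. -/
def sigmaPlus : Matrix (Fin 2) (Fin 2) ℂ := star sigmaMinus

/-- The operator acting as the 2×2 matrix `X` on the `l`-th field slice and as the
identity on the system and on all other slices. -/
def sliceOp {d N : ℕ} (l : Fin N) (X : Matrix (Fin 2) (Fin 2) ℂ) : TOp d N :=
  Matrix.of fun p q =>
    if p.1 = q.1 ∧ ∀ i : Fin N, i ≠ l → p.2 i = q.2 i then X (p.2 l) (q.2 l) else 0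

/-- The operator acting as the d×d matrix `S` on the system and as the identity on the
field, i.e. `S ⊗ I`. -/
def sys {d N : ℕ} (S : Matrix (Fin d) (Fin d) ℂ) : TOp d N :=
  Matrix.of fun p q => if p.2 = q.2 then S p.1 q.1 else 0

variable {d N : ℕ}

/-- `ΔA(l) = λ (σ₋)_l`. -/
def dA (lam : ℝ) (l : Fin N) : TOp d N := (lam : ℂ) • sliceOp l sigmaMinus

/-- `ΔΛ(l) = (σ₊σ₋)_l`. -/
def dLam (l : Fin N) : TOp d N := sliceOp l (sigmaPlus * sigmaMinus)

/-- `Δt(l) = λ² I`. -/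
def dt (d N : ℕ) (lam : ℝ) : TOp d N := ((lam : ℂ) ^ 2) • 1

/-- `ΔW(l) = ΔA(l) + ΔA(l)*`. -/
def dW (lam : ℝ) (l : Fin N) : TOp d N := dA lam l + star (dA lam l)

variable (lam : ℝ) (Mpm Mp Mm Mo : Matrix (Fin d) (Fin d) ℂ)

/-- `M_l = I + Mpm ΔΛ(l) + Mp ΔA(l)* + Mm ΔA(l) + Mo Δt(l)`. -/
def Mmat (l : Fin N) : TOp d N :=
  1 + sys Mpm * dLam l + sys Mp * star (dA lam l) + sys Mm * dA lam l + sys Mo * dt d N lam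

/-- `U(0) = I`, `U(l) = M_l U(l−1)` (slices are 0-indexed: paper `M_{l+1}` is `Mmat ⟨l,_⟩`). -/
def Umat : ℕ → TOp d N
  | 0 => 1
  | l + 1 => (if h : l < N then Mmat lam Mpm Mp Mm Mo ⟨l, h⟩ else 1) * Umat l

/-- The flow `j_l(X) = U(l)* X U(l)`. -/
def jmap (l : ℕ) (X : TOp d N) : TOp d N :=
  star (Umat lam Mpm Mp Mm Mo l) * X * Umat lam Mpm Mp Mm Mo l

/-- The output increment `ΔY(l) = U(l)* ΔW(l) U(l)` (for `l : Fin N`, this is the paper's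
`ΔY(l+1)`, i.e. paper-time `l+1`). -/
def dY (l : Fin N) : TOp d N :=
  star (Umat lam Mpm Mp Mm Mo (l.1 + 1)) * dW lam l * Umat lam Mpm Mp Mm Mo (l.1 + 1)

end DiscreteField

theorem sliceOp_mul_apply {d N : ℕ} (l : Fin N) (X : Matrix (Fin 2) (Fin 2) ℂ)
    (B : TOp d N) (p q : TIdx d N) :
    (sliceOp l X * B : TOp d N) p q = ∑ a, X (p.2 l) a * B (p.1, Function.update p.2 l a) q := by
  rw [Matrix.mul_apply]
  symm
  apply Finset.sum_of_injOn (fun a => (p.1, Function.update p.2 l a))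
  · intro a _ b _ h
    exact Function.update_injective p.2 l (Prod.ext_iff.1 h).2
  · intro a _
    simp
  · rintro r - hr
    have : ¬ (p.1 = r.1 ∧ ∀ i : Fin N, i ≠ l → p.2 i = r.2 i) := by
      rintro ⟨h1, h2⟩
      refine hr ⟨r.2 l, by simp, Prod.ext h1 (Function.update_eq_iff.2 ⟨rfl, h2⟩)⟩
    simp [sliceOp, this]
  · intro a _
    have : ∀ i : Fin N, i ≠ l → p.2 i = Function.update p.2 l a i := fun i hi => by simp [hi]
    simp only [sliceOp, Matrix.of_apply, Function.update_self]
    rw [if_pos ⟨trivial, this⟩]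

theorem star_sliceOp {d N : ℕ} (l : Fin N) (X : Matrix (Fin 2) (Fin 2) ℂ) :
    star (sliceOp l X : TOp d N) = sliceOp l (star X) := by
  ext p q
  simp only [sliceOp, Matrix.star_apply, Matrix.of_apply, apply_ite star, star_zero]
  simp only [eq_comm]

theorem mul_sliceOp_apply {d N : ℕ} (l : Fin N) (X : Matrix (Fin 2) (Fin 2) ℂ)
    (B : TOp d N) (p q : TIdx d N) :
    (B * sliceOp l X : TOp d N) p q = ∑ a, B p (q.1, Function.update q.2 l a) * X a (q.2 l) := by
  have h := congrArg star (sliceOp_mul_apply l (star X) (star B) q p)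
  rw [← star_sliceOp, ← star_mul, Matrix.star_apply, star_star] at h
  simpa [Matrix.star_apply, mul_comm] using h

theorem commute_sliceOp_sliceOp {d N : ℕ} {l m : Fin N} (hlm : l ≠ m)
    (X Y : Matrix (Fin 2) (Fin 2) ℂ) :
    Commute (sliceOp l X : TOp d N) (sliceOp m Y) := by
  ext p q
  rw [sliceOp_mul_apply, mul_sliceOp_apply, Finset.sum_eq_single (q.2 l),
    Finset.sum_eq_single (p.2 l)]
  · have : (∀ i : Fin N, i ≠ m → Function.update p.2 l (q.2 l) i = q.2 i) ↔
        ∀ i : Fin N, i ≠ m → p.2 i = Function.update q.2 l (p.2 l) i :=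
      forall₂_congr fun i _ => by
        by_cases h : i = l
        · subst h; simp
        · simp [h]
    simp only [sliceOp, Matrix.of_apply, this, Function.update_of_ne hlm.symm, mul_comm]
  · intro a _ ha
    have : ¬ ∀ i : Fin N, i ≠ m → p.2 i = Function.update q.2 l a i := fun h =>
      ha (by simpa using (h l hlm).symm)
    simp [sliceOp, this]
  · simp
  · intro a _ ha
    have : ¬ ∀ i : Fin N, i ≠ m → Function.update p.2 l a i = q.2 i := fun h =>
      ha (by simpa using h l hlm)
    simp [sliceOp, this]
  · simp

theorem commute_sliceOp_sys {d N : ℕ} (l : Fin N) (X : Matrix (Fin 2) (Fin 2) ℂ)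
    (S : Matrix (Fin d) (Fin d) ℂ) :
    Commute (sliceOp l X : TOp d N) (sys S) := by
  ext p q
  rw [sliceOp_mul_apply, mul_sliceOp_apply, Finset.sum_eq_single (q.2 l),
    Finset.sum_eq_single (p.2 l)]
  · simp only [sys, Matrix.of_apply, Function.update_eq_iff, Function.eq_update_iff,
      true_and, mul_comm]
  · intro a _ ha
    simp [sys, Function.eq_update_iff, Ne.symm ha]
  · simp
  · intro a _ ha
    simp [sys, Function.update_eq_iff, ha]
  · simp

theorem commute_sliceOp_Mmat {d N : ℕ} (lam : ℝ) (Mpm Mp Mm Mo : Matrix (Fin d) (Fin d) ℂ)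
    {l m : Fin N} (hlm : l ≠ m) (X : Matrix (Fin 2) (Fin 2) ℂ) :
    Commute (sliceOp l X) (Mmat lam Mpm Mp Mm Mo m) := by
  have hs := commute_sliceOp_sys (d := d) l X
  have hc := commute_sliceOp_sliceOp (d := d) hlm X
  have hA : Commute (sliceOp l X : TOp d N) (dA lam m) := (hc _).smul_right _
  have hA' : Commute (sliceOp l X : TOp d N) (star (dA lam m)) := by
    rw [dA, star_smul, star_sliceOp]
    exact (hc _).smul_right _
  exact ((((Commute.one_right _).add_right ((hs _).mul_right (hc _))).add_right
    ((hs _).mul_right hA')).add_right ((hs _).mul_right hA)).add_right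
    ((hs _).mul_right ((Commute.one_right _).smul_right _))

theorem commute_dW_Mmat {d N : ℕ} (lam : ℝ) (Mpm Mp Mm Mo : Matrix (Fin d) (Fin d) ℂ)
    {l m : Fin N} (hlm : l ≠ m) :
    Commute (dW lam l) (Mmat lam Mpm Mp Mm Mo m) := by
  rw [dW, dA, star_smul, star_sliceOp]
  exact ((commute_sliceOp_Mmat lam Mpm Mp Mm Mo hlm _).smul_left _).add_left
    ((commute_sliceOp_Mmat lam Mpm Mp Mm Mo hlm _).smul_left _)

/-- For `1 ≤ l ≤ k ≤ N`, `U(k)* ΔW(l) U(k) = U(l)* ΔW(l) U(l) = ΔY(l)`: the output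
increment is unchanged by conjugation with any later unitary.
(Here `l : Fin N` denotes the paper's time `l+1`, so the paper condition `l ≤ k` reads
`l.1 + 1 ≤ k`.) -/
theorem output_increment_conjugation_invariant {d N : ℕ} (hd : 0 < d) {lam : ℝ}
    (hlam : 0 < lam) (Mpm Mp Mm Mo : Matrix (Fin d) (Fin d) ℂ)
    (hU : ∀ l : Fin N, Mmat lam Mpm Mp Mm Mo l ∈ Matrix.unitaryGroup (TIdx d N) ℂ)
    (l : Fin N) (k : ℕ) (hlk : l.1 + 1 ≤ k) (hkN : k ≤ N) :
    star (Umat lam Mpm Mp Mm Mo k) * dW lam l * Umat lam Mpm Mp Mm Mo k =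
      dY lam Mpm Mp Mm Mo l := by
  induction k, hlk using Nat.le_induction with
  | base => rfl
  | succ k hlk ih =>
    rw [← ih (by omega), Umat, dif_pos (show k < N by omega)]
    have hne : l ≠ ⟨k, by omega⟩ := fun h => by
      have := congrArg Fin.val h
      simp only at this
      omega
    have hc := (commute_dW_Mmat lam Mpm Mp Mm Mo hne).eq
    have hu := Matrix.mem_unitaryGroup_iff'.1 (hU ⟨k, by omega⟩)
    generalize Mmat lam Mpm Mp Mm Mo ⟨k, _⟩ = M at hc hu ⊢
    calc star (M * Umat lam Mpm Mp Mm Mo k) * dW lam l * (M * Umat lam Mpm Mp Mm Mo k)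
        = star (Umat lam Mpm Mp Mm Mo k) * (star M * (dW lam l * M)) *
            Umat lam Mpm Mp Mm Mo k := by
          simp only [star_mul, mul_assoc]
      _ = _ := by rw [hc, ← mul_assoc (star M), hu, one_mul]
end

section
/- (Unitarity constraint on the interaction coefficients.) If for some 1 ≤ l ≤ N the matrix M_l := I + Mpm·ΔΛ(l) + Mp·ΔA(l)* + Mm·ΔA(l) + Mo·Δt(l) is unitary, then the d×d system matrices satisfy Mo + Mo* + Mp*·Mp + λ²·Mo*·Mo = 0. -/
open Matrix
open scoped ComplexOrder BigOperators

theorem sys_apply {d N : ℕ} (S : Matrix (Fin d) (Fin d) ℂ) (a b : Fin d)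
    (f g : Fin N → Fin 2) :
    (sys S : TOp d N) (a, f) (b, g) = if f = g then S a b else 0 := rfl

theorem sys_mul_apply {d N : ℕ} (S : Matrix (Fin d) (Fin d) ℂ) (T : TOp d N)
    (a b : Fin d) (f g : Fin N → Fin 2) :
    (sys S * T : TOp d N) (a, f) (b, g) = ∑ c, S a c * T (c, f) (b, g) := by
  simp [Matrix.mul_apply, sys, Fintype.sum_prod_type, ite_mul]

theorem sys_mul_sliceOp_apply {d N : ℕ} (S : Matrix (Fin d) (Fin d) ℂ) (l : Fin N)
    (X : Matrix (Fin 2) (Fin 2) ℂ) (a b : Fin d) (f g : Fin N → Fin 2) :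
    (sys S * sliceOp l X : TOp d N) (a, f) (b, g) =
      if ∀ i, i ≠ l → f i = g i then S a b * X (f l) (g l) else 0 := by
  rw [sys_mul_apply]
  by_cases h : ∀ i, i ≠ l → f i = g i
  · simp [sliceOp, if_pos h, and_iff_left h, mul_ite]
  · simp [sliceOp, h]

theorem star_dA {d N : ℕ} (lam : ℝ) (l : Fin N) :
    star (dA lam l : TOp d N) = (lam : ℂ) • sliceOp l sigmaPlus := by
  simp [dA, star_smul, star_sliceOp, sigmaPlus]

theorem update_one_zero_ne {N : ℕ} (l : Fin N) :
    Function.update (1 : Fin N → Fin 2) l 0 ≠ 1 := fun h => by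
  simpa using congrFun h l

/-- Configurations agreeing with the ground state `1` away from the slice `l`. -/
theorem eq_one_or_eq_update_iff {N : ℕ} (l : Fin N) (f : Fin N → Fin 2) :
    (∀ i, i ≠ l → f i = 1) ↔ f = 1 ∨ f = (Function.update 1 l 0 : Fin N → Fin 2) := by
  constructor
  · intro h
    have hl : f l = 0 ∨ f l = 1 := by
      generalize f l = x
      fin_cases x <;> simp
    rcases hl with hl | hl
    · right
      ext i
      by_cases hi : i = l
      · subst hi; simp [hl]
      · simp [hi, h i hi]
    · left
      ext i
      by_cases hi : i = l
      · subst hi; simp [hl]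
      · simp [h i hi]
  · rintro (rfl | rfl) i hi <;> simp [hi]

/-- The columns of `M_l` at the ground state of the field. -/
theorem Mmat_apply_one {d N : ℕ} (lam : ℝ) (Mpm Mp Mm Mo : Matrix (Fin d) (Fin d) ℂ)
    (l : Fin N) (a b : Fin d) (f : Fin N → Fin 2) :
    Mmat lam Mpm Mp Mm Mo l (a, f) (b, 1) =
      (if f = 1 then (1 + (lam : ℂ) ^ 2 • Mo) a b else 0) +
        if f = (Function.update 1 l 0 : Fin N → Fin 2) then ((lam : ℂ) • Mp) a b else 0 := by
  have hone : (1 : TOp d N) (a, f) (b, 1) =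
      if f = 1 then (1 : Matrix (Fin d) (Fin d) ℂ) a b else 0 := by
    simp only [Matrix.one_apply, Prod.mk.injEq]
    split_ifs <;> simp_all
  have hne := update_one_zero_ne l
  rw [Mmat, star_dA]
  simp only [dt, dLam, dA, Matrix.mul_smul, Matrix.mul_one, Matrix.add_apply,
    Matrix.smul_apply, sys_mul_sliceOp_apply, hone, sys_apply, Pi.one_apply,
    eq_one_or_eq_update_iff]
  by_cases h1 : f = 1
  · subst h1
    simp [hne.symm, sigmaPlus, sigmaMinus, Matrix.mul_apply, Matrix.star_apply]
  · by_cases h2 : f = (Function.update 1 l 0 : Fin N → Fin 2)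
    · subst h2
      simp [hne, sigmaPlus, sigmaMinus, Matrix.mul_apply, Matrix.star_apply]
    · simp [h1, h2]

/-- The compression of `M_l* M_l` to the ground state of the field. -/
theorem star_Mmat_mul_Mmat_apply_one {d N : ℕ} (lam : ℝ)
    (Mpm Mp Mm Mo : Matrix (Fin d) (Fin d) ℂ) (l : Fin N) (a b : Fin d) :
    (star (Mmat lam Mpm Mp Mm Mo l) * Mmat lam Mpm Mp Mm Mo l) (a, 1) (b, 1) =
      (star (1 + (lam : ℂ) ^ 2 • Mo) * (1 + (lam : ℂ) ^ 2 • Mo) +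
        star ((lam : ℂ) • Mp) * ((lam : ℂ) • Mp)) a b := by
  have hne := update_one_zero_ne l
  rw [Matrix.mul_apply, Matrix.add_apply, Matrix.mul_apply, Matrix.mul_apply,
    Fintype.sum_prod_type, ← Finset.sum_add_distrib]
  refine Finset.sum_congr rfl fun c _ => ?_
  simp only [Matrix.star_apply, Mmat_apply_one]
  rw [Fintype.sum_eq_add 1 (Function.update 1 l 0 : Fin N → Fin 2) hne.symm]
  · simp only [if_true, if_neg hne, if_neg hne.symm, add_zero, zero_add]
  · rintro f ⟨h1, h2⟩
    simp [h1, h2]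

/-- Unitarity constraint on the interaction coefficients: if some
`M_l = I + Mpm ΔΛ(l) + Mp ΔA(l)* + Mm ΔA(l) + Mo Δt(l)` is unitary, then
`Mo + Mo* + Mp* Mp + λ² Mo* Mo = 0`. -/
theorem unitarity_constraint {d N : ℕ} (hd : 0 < d) {lam : ℝ} (hlam : 0 < lam)
    (Mpm Mp Mm Mo : Matrix (Fin d) (Fin d) ℂ) (l : Fin N)
    (hU : Mmat lam Mpm Mp Mm Mo l ∈ Matrix.unitaryGroup (TIdx d N) ℂ) :
    Mo + star Mo + star Mp * Mp + ((lam : ℂ) ^ 2) • (star Mo * Mo) = 0 := by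
  have key : star (1 + (lam : ℂ) ^ 2 • Mo) * (1 + (lam : ℂ) ^ 2 • Mo) +
      star ((lam : ℂ) • Mp) * ((lam : ℂ) • Mp) = 1 := by
    ext a b
    rw [← star_Mmat_mul_Mmat_apply_one lam Mpm Mp Mm Mo l a b,
      Matrix.mem_unitaryGroup_iff'.mp hU]
    simp [Matrix.one_apply]
  have hc : (lam : ℂ) ^ 2 ≠ 0 := pow_ne_zero _ (by exact_mod_cast hlam.ne')
  refine (smul_eq_zero_iff_right hc).mp ?_
  rw [← sub_eq_zero.mpr key]
  simp only [star_add, star_one, star_smul, star_pow, Complex.star_def, Complex.conj_ofReal,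
    add_mul, mul_add, one_mul, mul_one, smul_mul_assoc, mul_smul_comm, smul_smul, smul_add]
  module
end

section
/- (Algebraic form of the discrete quantum filtering (Zakai) recursion.) Define V(0) := I and V(l) := [I + Mp·ΔW(l) + Mo·Δt(l)]·V(l−1) for 1 ≤ l ≤ N. Then for every d×d complex matrix X (identified with X ⊗ I) and every 1 ≤ l ≤ N: V(l)*·X·V(l) − V(l−1)*·X·V(l−1) = V(l−1)*·L(X)·V(l−1)·Δt(l) + V(l−1)*·J(X)·V(l−1)·ΔW(l), where L(X) := Mp*·X·Mp + λ²·Mo*·X·Mo + X·Mo + Mo*·X and J(X) := λ²·Mp*·X·Mo + λ²·Mo*·X·Mp + X·Mp + Mp*·X. -/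
open Matrix
open scoped ComplexOrder BigOperators

noncomputable section

variable {d N : ℕ}

/-- The reference process `V(0) = I`, `V(l) = [I + Mp ΔW(l) + Mo Δt(l)] V(l−1)`
(0-indexed slices: the step from `V(l)` to `V(l+1)` uses `ΔW` at slice `⟨l,_⟩`). -/
def Vc (lam : ℝ) (Mp Mo : Matrix (Fin d) (Fin d) ℂ) : ℕ → TOp d N
  | 0 => 1
  | l + 1 =>
      (1 + (if h : l < N then sys Mp * dW lam ⟨l, h⟩ else 0) + sys Mo * dt d N lam) *
        Vc lam Mp Mo l

end

/-- The tensor product of a finite family of square matrices. -/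
def piKronecker {ι n : Type*} [Fintype ι] (A : ι → Matrix n n ℂ) : Matrix (ι → n) (ι → n) ℂ :=
  Matrix.of fun p q => ∏ i, A i (p i) (q i)

theorem piKronecker_mul {ι n : Type*} [Fintype ι] [DecidableEq ι] [Fintype n]
    (A B : ι → Matrix n n ℂ) : piKronecker A * piKronecker B = piKronecker (A * B) := by
  ext p q
  simp only [piKronecker, Matrix.mul_apply, Matrix.of_apply, Pi.mul_apply,
    Finset.prod_univ_sum, Fintype.piFinset_univ, Finset.prod_mul_distrib]

theorem piKronecker_one {ι n : Type*} [Fintype ι] [DecidableEq n] :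
    piKronecker (1 : ι → Matrix n n ℂ) = 1 := by
  ext p q
  simp [piKronecker, Matrix.one_apply, Finset.prod_ite_zero, funext_iff]

theorem sliceOp_eq_kronecker {d N : ℕ} (l : Fin N) (X : Matrix (Fin 2) (Fin 2) ℂ) :
    (sliceOp l X : TOp d N) =
      Matrix.kronecker 1 (piKronecker (Pi.mulSingle l X)) := by
  ext p q
  have key : ∏ i, (Pi.mulSingle l X : Fin N → Matrix (Fin 2) (Fin 2) ℂ) i (p.2 i) (q.2 i) =
      if ∀ i, i ≠ l → p.2 i = q.2 i then X (p.2 l) (q.2 l) else 0 := by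
    rw [← Finset.mul_prod_erase Finset.univ _ (Finset.mem_univ l), Pi.mulSingle_eq_same,
      Finset.prod_congr rfl (g := fun i => if p.2 i = q.2 i then (1 : ℂ) else 0),
      Finset.prod_ite_zero]
    · simp
    · intro i hi
      rw [Pi.mulSingle_eq_of_ne (Finset.ne_of_mem_erase hi), Matrix.one_apply]
  simp only [sliceOp, Matrix.of_apply, Matrix.kronecker, Matrix.kroneckerMap_apply, piKronecker,
    key, Matrix.one_apply]
  split_ifs <;> simp_all

theorem sys_eq_kronecker {d N : ℕ} (S : Matrix (Fin d) (Fin d) ℂ) :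
    (sys S : TOp d N) = Matrix.kronecker S 1 := by
  ext p q
  simp [sys, Matrix.kronecker, Matrix.one_apply]

theorem sliceOp_mul {d N : ℕ} (l : Fin N) (X Y : Matrix (Fin 2) (Fin 2) ℂ) :
    (sliceOp l X * sliceOp l Y : TOp d N) = sliceOp l (X * Y) := by
  simp only [sliceOp_eq_kronecker, Matrix.kronecker, ← Matrix.mul_kronecker_mul, one_mul,
    piKronecker_mul, Pi.mulSingle_mul]

theorem sliceOp_one {d N : ℕ} (l : Fin N) : (sliceOp l 1 : TOp d N) = 1 := by
  rw [sliceOp_eq_kronecker, Pi.mulSingle_one, piKronecker_one]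
  exact Matrix.one_kronecker_one

theorem sliceOp_add {d N : ℕ} (l : Fin N) (X Y : Matrix (Fin 2) (Fin 2) ℂ) :
    (sliceOp l (X + Y) : TOp d N) = sliceOp l X + sliceOp l Y := by
  ext p q
  simp only [sliceOp, Matrix.of_apply, Matrix.add_apply]
  split_ifs <;> simp

theorem sliceOp_commute {d N : ℕ} {l m : Fin N} (h : l ≠ m) (X Y : Matrix (Fin 2) (Fin 2) ℂ) :
    Commute (sliceOp l X : TOp d N) (sliceOp m Y) := by
  have key := (Pi.mulSingle_commute (f := fun _ : Fin N => Matrix (Fin 2) (Fin 2) ℂ) h X Y).eq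
  simp only [commute_iff_eq, sliceOp_eq_kronecker, Matrix.kronecker, ← Matrix.mul_kronecker_mul,
    piKronecker_mul, key]

theorem sys_commute_sliceOp {d N : ℕ} (S : Matrix (Fin d) (Fin d) ℂ) (l : Fin N)
    (X : Matrix (Fin 2) (Fin 2) ℂ) : Commute (sys S : TOp d N) (sliceOp l X) := by
  simp only [commute_iff_eq, sliceOp_eq_kronecker, sys_eq_kronecker, Matrix.kronecker,
    ← Matrix.mul_kronecker_mul, one_mul, mul_one]

theorem sys_mul {d N : ℕ} (S T : Matrix (Fin d) (Fin d) ℂ) :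
    (sys (S * T) : TOp d N) = sys S * sys T := by
  simp only [sys_eq_kronecker, Matrix.kronecker, ← Matrix.mul_kronecker_mul, one_mul]

theorem sys_add {d N : ℕ} (S T : Matrix (Fin d) (Fin d) ℂ) :
    (sys (S + T) : TOp d N) = sys S + sys T := by
  simp only [sys_eq_kronecker]
  exact Matrix.add_kronecker _ _ _

theorem sys_smul {d N : ℕ} (c : ℂ) (S : Matrix (Fin d) (Fin d) ℂ) :
    (sys (c • S) : TOp d N) = c • sys S := by
  simp only [sys_eq_kronecker]
  exact Matrix.smul_kronecker _ _ _

theorem star_sys {d N : ℕ} (S : Matrix (Fin d) (Fin d) ℂ) :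
    star (sys S : TOp d N) = sys (star S) := by
  ext p q
  simp only [sys, Matrix.star_apply, Matrix.of_apply, eq_comm]
  split_ifs <;> simp

theorem dW_eq_smul_sliceOp {d N : ℕ} (lam : ℝ) (l : Fin N) :
    (dW lam l : TOp d N) = (lam : ℂ) • sliceOp l (sigmaMinus + sigmaPlus) := by
  simp [dW, dA, sliceOp_add, star_sliceOp, sigmaPlus]

theorem dW_mul_self {d N : ℕ} (lam : ℝ) (l : Fin N) :
    (dW lam l * dW lam l : TOp d N) = (lam : ℂ) ^ 2 • 1 := by
  have key : (sigmaMinus + sigmaPlus) * (sigmaMinus + sigmaPlus) = 1 := by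
    ext i j
    fin_cases i <;> fin_cases j <;>
      simp [sigmaMinus, sigmaPlus, Matrix.mul_apply, Fin.sum_univ_two]
  rw [dW_eq_smul_sliceOp, smul_mul_smul_comm, sliceOp_mul, key, sliceOp_one, pow_two]

theorem star_dW {d N : ℕ} (lam : ℝ) (l : Fin N) : star (dW lam l : TOp d N) = dW lam l := by
  simp [dW, add_comm]

theorem sys_commute_dW {d N : ℕ} (S : Matrix (Fin d) (Fin d) ℂ) (lam : ℝ) (l : Fin N) :
    Commute (sys S : TOp d N) (dW lam l) := by
  rw [dW_eq_smul_sliceOp]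
  exact (sys_commute_sliceOp _ _ _).smul_right _

theorem dW_commute {d N : ℕ} (lam : ℝ) (l m : Fin N) :
    Commute (dW lam l : TOp d N) (dW lam m) := by
  rcases eq_or_ne l m with rfl | h
  · exact Commute.refl _
  · simp only [dW_eq_smul_sliceOp]
    exact ((sliceOp_commute h _ _).smul_right _).smul_left _

theorem Vc_commute_dW {d N : ℕ} (lam : ℝ) (Mp Mo : Matrix (Fin d) (Fin d) ℂ) (k : ℕ) (l : Fin N) :
    Commute (Vc lam Mp Mo k : TOp d N) (dW lam l) := by
  induction k with
  | zero => exact Commute.one_left _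
  | succ k ih =>
    refine Commute.mul_left (((Commute.one_left _).add_left ?_).add_left ?_) ih
    · split_ifs
      · exact (sys_commute_dW _ _ _).mul_left (dW_commute _ _ _)
      · exact Commute.zero_left _
    · exact (sys_commute_dW _ _ _).mul_left ((Commute.one_left _).smul_left _)

/-- The increment of `X ↦ G* X G` for `G = 1 + P W + c R`, where `W` is a self-adjoint element
with `W² = c` that commutes with `P`, `P*` and `X`. -/
theorem star_mul_mul_sub_of_mul_self {A : Type*} [Ring A] [StarRing A] [Algebra ℂ A]
    [StarModule ℂ A]
    {W P R X : A} {c : ℂ} (hc : star c = c) (hW : W * W = c • 1) (hsW : star W = W)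
    (hP : Commute P W) (hP' : Commute (star P) W) (hR : Commute R W) (hX : Commute X W) :
    star (1 + P * W + c • R) * X * (1 + P * W + c • R) - X =
      c • (star P * X * P + c • (star R * X * R) + X * R + star R * X) +
        (c • (star P * X * R) + c • (star R * X * P) + X * P + star P * X) * W := by
  have h : star (1 + P * W + c • R) = 1 + star P * W + c • star R := by
    simp [hsW, hc, hP'.eq]
  have h₁ : star P * W * X = star P * X * W := by rw [mul_assoc, ← hX.eq, mul_assoc]
  have h₂ : star P * X * W * R = star P * X * R * W := by
    rw [mul_assoc, ← hR.eq, ← mul_assoc]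
  have h₃ : star P * X * W * (P * W) = c • (star P * X * P) := by
    rw [← mul_assoc, mul_assoc (star P * X), ← hP.eq, ← mul_assoc, mul_assoc, hW, mul_smul_comm,
      mul_one]
  rw [h]
  simp only [add_mul, mul_add, one_mul, mul_one, smul_mul_assoc, mul_smul_comm, smul_add, h₁, h₂, h₃,
    ← mul_assoc (star R * X) P W, ← mul_assoc X P W]
  abel

/-- Algebraic form of the discrete quantum filtering (Zakai) recursion:
`V(l)* X V(l) − V(l−1)* X V(l−1)
  = V(l−1)* L(X) V(l−1) Δt(l) + V(l−1)* J(X) V(l−1) ΔW(l)`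
where `L(X) = Mp* X Mp + λ² Mo* X Mo + X Mo + Mo* X` and
`J(X) = λ² Mp* X Mo + λ² Mo* X Mp + X Mp + Mp* X`. -/
theorem discrete_zakai_recursion {d N : ℕ} (hd : 0 < d) {lam : ℝ} (hlam : 0 < lam)
    (Mp Mo : Matrix (Fin d) (Fin d) ℂ) (l : Fin N) (X : Matrix (Fin d) (Fin d) ℂ) :
    star (Vc lam Mp Mo (l.1 + 1) : TOp d N) * sys X * Vc lam Mp Mo (l.1 + 1) -
        star (Vc lam Mp Mo l.1 : TOp d N) * sys X * Vc lam Mp Mo l.1 =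
      star (Vc lam Mp Mo l.1 : TOp d N) *
          sys (star Mp * X * Mp + ((lam : ℂ) ^ 2) • (star Mo * X * Mo) + X * Mo + star Mo * X) *
          Vc lam Mp Mo l.1 * dt d N lam +
        star (Vc lam Mp Mo l.1 : TOp d N) *
          sys (((lam : ℂ) ^ 2) • (star Mp * X * Mo) + ((lam : ℂ) ^ 2) • (star Mo * X * Mp) +
            X * Mp + star Mp * X) *
          Vc lam Mp Mo l.1 * dW lam l := by
  have key := star_mul_mul_sub_of_mul_self (c := (lam : ℂ) ^ 2) (by simp) (dW_mul_self lam l)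
    (star_dW lam l) (sys_commute_dW Mp lam l)
    (by rw [star_sys]; exact sys_commute_dW (star Mp) lam l) (sys_commute_dW Mo lam l)
    (sys_commute_dW X lam l)
  have hV : (Vc lam Mp Mo (l.1 + 1) : TOp d N) =
      (1 + sys Mp * dW lam l + (lam : ℂ) ^ 2 • sys Mo) * Vc lam Mp Mo l.1 := by
    simp [Vc, dt]
  have hcomm := (Vc_commute_dW lam Mp Mo l.1 l).eq
  simp only [sys_add, sys_smul, sys_mul, ← star_sys]
  generalize (Vc lam Mp Mo l.1 : TOp d N) = V at hV hcomm ⊢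
  rw [hV, star_mul, mul_assoc _ V (dW lam l), hcomm]
  calc
    _ = star V * (star (1 + sys Mp * dW lam l + (lam : ℂ) ^ 2 • sys Mo) * sys X *
          (1 + sys Mp * dW lam l + (lam : ℂ) ^ 2 • sys Mo) - sys X) * V := by
      simp only [mul_sub, sub_mul, mul_assoc]
    _ = _ := by
      rw [key, mul_add, add_mul]
      simp only [dt, mul_smul_comm, smul_mul_assoc, mul_one, mul_assoc]
end
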